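/- arXiv:1402.6682 — 2 statements merged into one kernel-verified Lean document; each statement's English description precedes it below -/
import Mathlib

section
/- For all real x and all L > 0, |sgn(x) − ∫_0^L G(u/L) sin(2πux) du/u| ≤ C · (sin(πLx)/(πLx))^2 for an absolute constant C, where G(u) = 2u/π + 2(1−u)u·cot(πu) for u ∈ (0,1), extended continuously to [0,1]. Moreover G is differentiable on [0,1] and 0 ≤ G(u) ≤ 2/π for all u ∈ [0,1]. -/
open Real

/-- Selberg's function `G(u) = 2u/π + 2(1-u)u·cot(πu)`, extended continuously to `[0,1]`. -/
noncomputable def selbergG (u : ℝ) : ℝ :=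
  if u = 0 then 2 / Real.pi
  else if u = 1 then 0
  else 2 * u / Real.pi + 2 * (1 - u) * u * (Real.cos (Real.pi * u) / Real.sin (Real.pi * u))

open Set Filter MeasureTheory intervalIntegral
open scoped Topology FourierTransform

theorem differentiable_sinc : Differentiable ℝ sinc := by
  intro x
  rw [sinc_eq_dslope]
  rcases eq_or_ne x 0 with rfl | hx
  · obtain ⟨p, hp⟩ : AnalyticAt ℝ sin 0 := analyticAt_sin
    exact hp.has_fpower_series_dslope_fslope.differentiableAt
  · exact (differentiableAt_dslope_of_ne hx).2 differentiableAt_sin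

theorem mul_sinc (x : ℝ) : x * sinc x = sin x := by
  rcases eq_or_ne x 0 with rfl | hx
  · simp
  · rw [sinc_of_ne_zero hx]; field_simp

theorem sinc_pi_mul_ne_zero {u : ℝ} (h0 : 0 ≤ u) (h1 : u < 1) : sinc (π * u) ≠ 0 := by
  rcases h0.eq_or_lt with rfl | h0
  · simp
  · intro h
    have h2 := mul_sinc (π * u)
    rw [h, mul_zero] at h2
    exact (sin_pos_of_pos_of_lt_pi (by positivity)
      (by nlinarith [pi_pos])).ne h2

theorem sin_pi_mul_pos {u : ℝ} (h : u ∈ Ioo (0 : ℝ) 1) : 0 < sin (π * u) :=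
  sin_pos_of_pos_of_lt_pi (mul_pos pi_pos h.1) (by nlinarith [pi_pos, h.2])

theorem selbergG_eq_of_lt_one {u : ℝ} (h0 : 0 ≤ u) (h1 : u < 1) :
    selbergG u = 2 * u / π + 2 * (1 - u) * cos (π * u) / (π * sinc (π * u)) := by
  rcases h0.eq_or_lt with rfl | h0
  · simp [selbergG]
  · have hs := sin_pi_mul_pos ⟨h0, h1⟩
    rw [selbergG, if_neg h0.ne', if_neg h1.ne, sinc_of_ne_zero (by positivity)]
    field_simp

theorem selbergG_eq_of_pos {u : ℝ} (h0 : 0 < u) (h1 : u ≤ 1) :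
    selbergG u = 2 * u / π - 2 * u * cos (π * (1 - u)) / (π * sinc (π * (1 - u))) := by
  rcases h1.eq_or_lt with rfl | h1
  · simp [selbergG]
  · have hs := sin_pi_mul_pos ⟨h0, h1⟩
    have h2 : π * (1 - u) = π - π * u := by ring
    have h3 : π * (1 - u) ≠ 0 := (mul_pos pi_pos (by linarith)).ne'
    have h4 : 1 - u ≠ 0 := by linarith
    rw [selbergG, if_neg h0.ne', if_neg h1.ne, sinc_of_ne_zero h3, h2, cos_pi_sub, sin_pi_sub, ← h2]
    field_simp
    ring

theorem differentiableWithinAt_selbergG {u : ℝ} (hu : u ∈ Icc (0 : ℝ) 1) :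
    DifferentiableWithinAt ℝ selbergG (Icc (0 : ℝ) 1) u := by
  have hd := differentiable_sinc
  rcases hu.2.eq_or_lt with rfl | h1
  · have hne : π * sinc (π * (1 - 1)) ≠ 0 := by simp
    have h : DifferentiableAt ℝ (fun u : ℝ ↦
        2 * u / π - 2 * u * cos (π * (1 - u)) / (π * sinc (π * (1 - u)))) 1 := by
      fun_prop (disch := assumption)
    refine h.differentiableWithinAt.congr_of_eventuallyEq ?_ (selbergG_eq_of_pos one_pos le_rfl)
    filter_upwards [self_mem_nhdsWithin, mem_nhdsWithin_of_mem_nhds (Ioi_mem_nhds one_pos)]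
      with v hv hv'
    exact selbergG_eq_of_pos hv' hv.2
  · have hne : π * sinc (π * u) ≠ 0 := mul_ne_zero pi_ne_zero (sinc_pi_mul_ne_zero hu.1 h1)
    have h : DifferentiableAt ℝ (fun u : ℝ ↦
        2 * u / π + 2 * (1 - u) * cos (π * u) / (π * sinc (π * u))) u := by
      fun_prop (disch := assumption)
    refine h.differentiableWithinAt.congr_of_eventuallyEq ?_ (selbergG_eq_of_lt_one hu.1 h1)
    filter_upwards [self_mem_nhdsWithin, mem_nhdsWithin_of_mem_nhds (Iio_mem_nhds h1)]
      with v hv hv'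
    exact selbergG_eq_of_lt_one hv.1 hv'

theorem continuousOn_selbergG : ContinuousOn selbergG (Icc (0 : ℝ) 1) :=
  fun _ hu ↦ (differentiableWithinAt_selbergG hu).continuousWithinAt

theorem mul_cos_le_sin {x : ℝ} (h0 : 0 ≤ x) (h1 : x ≤ π) : x * cos x ≤ sin x := by
  rcases le_total (π / 2) x with h | h
  · have hc := cos_nonpos_of_pi_div_two_le_of_le h (by linarith)
    have hs := sin_nonneg_of_nonneg_of_le_pi h0 h1
    nlinarith
  · rcases h.eq_or_lt with rfl | h
    · simp
    · have hc := cos_pos_of_mem_Ioo ⟨by linarith [pi_pos], h⟩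
      have ht := le_tan h0 h
      rwa [tan_eq_sin_div_cos, le_div_iff₀ hc] at ht

theorem selbergG_mem_Icc {u : ℝ} (hu : u ∈ Icc (0 : ℝ) 1) :
    0 ≤ selbergG u ∧ selbergG u ≤ 2 / π := by
  have hpi := pi_pos
  rcases hu.1.eq_or_lt with rfl | h0
  · simp [selbergG]
    positivity
  rcases hu.2.eq_or_lt with rfl | h1
  · simp [selbergG]
    positivity
  have hs := sin_pi_mul_pos ⟨h0, h1⟩
  have ha : π * u * cos (π * u) ≤ sin (π * u) := mul_cos_le_sin (by positivity) (by nlinarith)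
  have hb : π * (1 - u) * cos (π * (1 - u)) ≤ sin (π * (1 - u)) :=
    mul_cos_le_sin (mul_nonneg hpi.le (by linarith)) (by nlinarith)
  have h2 : π * (1 - u) = π - π * u := by ring
  rw [h2, cos_pi_sub, sin_pi_sub, ← h2] at hb
  rw [selbergG, if_neg h0.ne', if_neg h1.ne]
  constructor
  · have : 2 * u / π + 2 * (1 - u) * u * (cos (π * u) / sin (π * u)) =
        2 * u * (sin (π * u) - π * (1 - u) * -cos (π * u)) / (π * sin (π * u)) := by
      generalize sin (π * u) = s at hs
      field_simp
      ring
    rw [this]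
    exact div_nonneg (mul_nonneg (by positivity) (by linarith)) (by positivity)
  · have : 2 / π - (2 * u / π + 2 * (1 - u) * u * (cos (π * u) / sin (π * u))) =
        2 * (1 - u) * (sin (π * u) - π * u * cos (π * u)) / (π * sin (π * u)) := by
      field_simp
      ring
    have h3 : 0 ≤ 2 * (1 - u) * (sin (π * u) - π * u * cos (π * u)) / (π * sin (π * u)) :=
      div_nonneg (mul_nonneg (by linarith) (by linarith)) (by positivity)
    linarith

/-- The sine transform `∫₀¹ G(v) sin(2πvy) dv/v` of Selberg's function. -/
noncomputable def selbergH (y : ℝ) : ℝ :=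
  ∫ v in (0 : ℝ)..1, selbergG v * sin (2 * π * v * y) / v

theorem integral_selbergG_div (x : ℝ) {L : ℝ} (hL : 0 < L) :
    ∫ u in (0 : ℝ)..L, selbergG (u / L) * sin (2 * π * u * x) / u = selbergH (L * x) := by
  have h := integral_comp_div (a := 0) (b := L)
    (fun v ↦ selbergG v * sin (2 * π * v * (L * x)) / v) hL.ne'
  rw [zero_div, div_self hL.ne', smul_eq_mul] at h
  rw [selbergH, ← mul_right_inj' hL.ne', ← h, ← intervalIntegral.integral_const_mul]
  refine integral_congr fun u _ ↦ ?_
  have h2 : 2 * π * (u / L) * (L * x) = 2 * π * u * x := by field_simp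
  simp only [h2]
  rcases eq_or_ne u 0 with rfl | hu
  · simp
  · field_simp

theorem selbergH_neg (y : ℝ) : selbergH (-y) = -selbergH y := by
  rw [selbergH, selbergH, ← intervalIntegral.integral_neg]
  refine integral_congr fun v _ ↦ ?_
  simp only [mul_neg, sin_neg, neg_div]

theorem selbergH_zero : selbergH 0 = 0 := by simp [selbergH]

theorem intervalIntegrable_selbergG_mul_sin (y : ℝ) :
    IntervalIntegrable (fun v ↦ selbergG v * sin (2 * π * v * y) / v) volume 0 1 := by
  have hc : ContinuousOn (fun v ↦ selbergG v * (2 * π * y * sinc (2 * π * v * y)))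
      (uIcc (0 : ℝ) 1) := by
    rw [uIcc_of_le zero_le_one]
    refine continuousOn_selbergG.mul (Continuous.continuousOn ?_)
    have := continuous_sinc
    fun_prop
  refine hc.intervalIntegrable.congr fun v hv ↦ ?_
  rw [uIoc_of_le zero_le_one] at hv
  have hv0 := hv.1.ne'
  simp only [← mul_sinc (2 * π * v * y)]
  field_simp

theorem selbergH_add_one_sub (y : ℝ) :
    selbergH (y + 1) - selbergH y =
      2 / π * ((∫ v in (0 : ℝ)..1, sin (2 * π * (y + 1) * v)) - ∫ v in (0 : ℝ)..1, sin (2 * π * y * v))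
      + 2 * ((∫ v in (0 : ℝ)..1, (1 - v) * cos (2 * π * (y + 1) * v))
        + ∫ v in (0 : ℝ)..1, (1 - v) * cos (2 * π * y * v)) := by
  rw [selbergH, selbergH, ← intervalIntegral.integral_sub (intervalIntegrable_selbergG_mul_sin _)
    (intervalIntegrable_selbergG_mul_sin _)]
  rw [← intervalIntegral.integral_sub (Continuous.intervalIntegrable (by fun_prop) _ _)
      (Continuous.intervalIntegrable (by fun_prop) _ _),
    ← intervalIntegral.integral_add (Continuous.intervalIntegrable (by fun_prop) _ _)
      (Continuous.intervalIntegrable (by fun_prop) _ _),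
    ← intervalIntegral.integral_const_mul, ← intervalIntegral.integral_const_mul,
    ← intervalIntegral.integral_add (Continuous.intervalIntegrable (by fun_prop) _ _)
      (Continuous.intervalIntegrable (by fun_prop) _ _)]
  refine integral_congr_Ioo_of_le zero_le_one fun v hv ↦ ?_
  have hs := sin_pi_mul_pos hv
  have hv0 := hv.1.ne'
  have e1 : 2 * π * v * (y + 1) = 2 * π * v * y + 2 * (π * v) := by ring
  have e2 : 2 * π * (y + 1) * v = 2 * π * v * y + 2 * (π * v) := by ring
  have e3 : 2 * π * y * v = 2 * π * v * y := by ring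
  simp only [e1, e2, e3, selbergG, if_neg hv0, if_neg hv.2.ne]
  rw [sin_add, cos_add, sin_two_mul, cos_two_mul]
  have hsq := sin_sq_add_cos_sq (π * v)
  generalize 2 * π * v * y = a at *
  generalize sin (π * v) = s at *
  generalize cos (π * v) = c at *
  have hc : c ^ 2 = 1 - s ^ 2 := by linarith
  field_simp
  ring_nf
  simp only [show c ^ 3 = c * (1 - s ^ 2) by rw [← hc]; ring, hc]
  ring

theorem integral_sin_mul_zero_one {b : ℝ} (hb : b ≠ 0) :
    ∫ v in (0 : ℝ)..1, sin (b * v) = (1 - cos b) / b := by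
  rw [integral_comp_mul_left (fun x ↦ sin x) hb]
  simp [integral_sin]
  field_simp

theorem integral_one_sub_mul_cos {b : ℝ} (hb : b ≠ 0) :
    ∫ v in (0 : ℝ)..1, (1 - v) * cos (b * v) = (1 - cos b) / b ^ 2 := by
  have h : ∀ v ∈ uIcc (0 : ℝ) 1, HasDerivAt
      (fun v ↦ (1 - v) * sin (b * v) / b - cos (b * v) / b ^ 2) ((1 - v) * cos (b * v)) v := by
    intro v _
    have hm : HasDerivAt (fun v ↦ b * v) b v := by simpa using (hasDerivAt_id v).const_mul b
    have h1 : HasDerivAt (fun v : ℝ ↦ 1 - v) (-1) v := by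
      simpa using (hasDerivAt_id v).const_sub 1
    convert! ((h1.mul hm.sin).div_const b).sub (hm.cos.div_const (b ^ 2)) using 1
    field_simp
    ring
  rw [integral_eq_sub_of_hasDerivAt h (Continuous.intervalIntegrable (by fun_prop) _ _)]
  simp
  ring

theorem selbergH_add_one {y : ℝ} (hy : 0 < y) :
    selbergH (y + 1) - selbergH y = (sin (π * y) / π) ^ 2 * (1 / y - 1 / (y + 1)) ^ 2 := by
  have hpi := pi_pos
  rw [selbergH_add_one_sub, integral_sin_mul_zero_one (by positivity),
    integral_sin_mul_zero_one (by positivity), integral_one_sub_mul_cos (by positivity),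
    integral_one_sub_mul_cos (by positivity)]
  have h1 : cos (2 * π * (y + 1)) = cos (2 * π * y) := by
    rw [← cos_add_two_pi (2 * π * y)]; ring_nf
  have h2 : 1 - cos (2 * π * y) = 2 * sin (π * y) ^ 2 := by
    rw [mul_assoc, cos_two_mul, cos_sq']; ring
  rw [h1, h2]
  field_simp
  ring

theorem selbergH_one : selbergH 1 = 1 := by
  have h := selbergH_add_one_sub 0
  have h2 : ∫ v in (0 : ℝ)..1, (1 - v) = 1 / 2 := by
    rw [intervalIntegral.integral_sub (by simp) (by simp)]
    norm_num
  rw [integral_sin_mul_zero_one (by simp [pi_ne_zero]),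
    integral_one_sub_mul_cos (by simp [pi_ne_zero])] at h
  simpa [selbergH_zero, h2] using h

theorem selbergH_natCast_add_one (n : ℕ) : selbergH (n + 1) = 1 := by
  induction n with
  | zero => simp [selbergH_one]
  | succ n ih =>
    have h := selbergH_add_one (y := n + 1) (by positivity)
    have hs : sin (π * (n + 1)) = 0 := by
      have := sin_nat_mul_pi (n + 1)
      push_cast at this
      rwa [mul_comm] at this
    rw [hs, ih] at h
    push_cast
    simp only [zero_div, ne_eq, OfNat.ofNat_ne_zero, not_false_eq_true, zero_pow, zero_mul] at h
    linarith

theorem tendsto_integral_mul_cos {h : ℝ → ℝ} (hh : IntervalIntegrable h volume 0 1) :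
    Tendsto (fun w : ℝ ↦ ∫ v in (0 : ℝ)..1, h v * cos (2 * π * v * w)) (cocompact ℝ) (𝓝 0) := by
  have hi : Integrable ((Ioc (0 : ℝ) 1).indicator fun v ↦ (h v : ℂ)) := by
    rw [integrable_indicator_iff measurableSet_Ioc]
    exact ((intervalIntegrable_iff_integrableOn_Ioc_of_le zero_le_one).1 hh).ofReal
  have key := (Complex.continuous_re.tendsto 0).comp
    (Real.tendsto_integral_exp_smul_cocompact ((Ioc (0 : ℝ) 1).indicator fun v ↦ (h v : ℂ)))
  rw [Complex.zero_re] at key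
  refine key.congr fun w ↦ ?_
  have hiw : Integrable fun v : ℝ ↦
      𝐞 (-(v * w)) • (Ioc (0 : ℝ) 1).indicator (fun v ↦ (h v : ℂ)) v := by
    simpa [mul_comm] using (Real.fourierIntegral_convergent_iff (μ := volume) w).2 hi
  have hre := Complex.reCLM.integral_comp_comm hiw
  simp only [Complex.reCLM_apply] at hre
  rw [Function.comp_apply, ← hre, integral_of_le zero_le_one,
    ← MeasureTheory.integral_indicator measurableSet_Ioc]
  refine integral_congr_ae (Eventually.of_forall fun v ↦ ?_)
  by_cases hv : v ∈ Ioc (0 : ℝ) 1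
  · simp only [indicator_of_mem hv, Circle.smul_def, Real.fourierChar_apply, smul_eq_mul]
    rw [Complex.re_mul_ofReal, Complex.exp_ofReal_mul_I_re, mul_comm]
    congr 1
    rw [← cos_neg]
    congr 1
    ring
  · simp [indicator_of_notMem hv]

theorem tendsto_selbergH_add_natCast (y : ℝ) :
    Tendsto (fun n : ℕ ↦ selbergH (y + n)) atTop (𝓝 1) := by
  have hh : IntervalIntegrable (fun v ↦ selbergG v * (2 * π * y * sinc (π * v * y))) volume 0 1 := by
    refine ContinuousOn.intervalIntegrable ?_
    rw [uIcc_of_le zero_le_one]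
    refine continuousOn_selbergG.mul (Continuous.continuousOn ?_)
    have := continuous_sinc
    fun_prop
  have hw : Tendsto (fun n : ℕ ↦ (n : ℝ) + y / 2) atTop (cocompact ℝ) :=
    (tendsto_atTop_add_const_right _ _ tendsto_natCast_atTop_atTop).mono_right
      atTop_le_cocompact
  have hlim := ((tendsto_integral_mul_cos hh).comp hw).add_const 1
  rw [zero_add] at hlim
  refine hlim.congr' ?_
  filter_upwards [eventually_ge_atTop 1] with n hn
  obtain ⟨m, rfl⟩ := Nat.exists_eq_add_of_le' hn
  have h1 := selbergH_natCast_add_one m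
  rw [Function.comp_apply, ← eq_sub_iff_add_eq]
  rw [← Nat.cast_add_one] at h1
  generalize m + 1 = n at *
  refine Eq.trans (b := selbergH (y + n) - selbergH n) ?_ (by rw [h1])
  rw [selbergH, selbergH, ← intervalIntegral.integral_sub
    (intervalIntegrable_selbergG_mul_sin _) (intervalIntegrable_selbergG_mul_sin _)]
  refine integral_congr_Ioo_of_le zero_le_one fun v hv ↦ ?_
  have hv0 := hv.1.ne'
  have hsub := sin_sub_sin (2 * π * v * (y + n)) (2 * π * v * n)
  rw [show (2 * π * v * (y + n) - 2 * π * v * n) / 2 = π * v * y by ring,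
    show (2 * π * v * (y + n) + 2 * π * v * n) / 2 = 2 * π * v * (n + y / 2) by ring,
    ← mul_sinc (π * v * y)] at hsub
  rw [← sub_div, ← mul_sub, hsub]
  field_simp

theorem selbergH_add_natCast_mem {y : ℝ} (hy : 0 < y) (n : ℕ) :
    selbergH y ≤ selbergH (y + n) ∧
      selbergH (y + n) ≤ selbergH y + (sin (π * y) / π) ^ 2 * (1 / y ^ 2 - 1 / (y + n) ^ 2) := by
  induction n with
  | zero => simp
  | succ n ih =>
    have hyn : 0 < y + n := by positivity
    have h := selbergH_add_one hyn
    have hs : sin (π * (y + n)) ^ 2 = sin (π * y) ^ 2 := by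
      rw [mul_add, mul_comm π (n : ℝ), sin_add_nat_mul_pi, mul_pow, ← pow_mul, mul_comm n 2,
        pow_mul]
      simp
    rw [div_pow, hs, ← div_pow, add_assoc] at h
    have h0 : 0 ≤ 1 / (y + n + 1) := by positivity
    have h1 : 1 / (y + n + 1) ≤ 1 / (y + n) := one_div_le_one_div_of_le hyn (by linarith)
    have h2 : (1 / (y + n) - 1 / (y + n + 1)) ^ 2 ≤ 1 / (y + n) ^ 2 - 1 / (y + n + 1) ^ 2 := by
      rw [← one_div_pow, ← one_div_pow]
      nlinarith
    rw [← add_assoc] at h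
    push_cast
    rw [← add_assoc]
    have hS : 0 ≤ (sin (π * y) / π) ^ 2 := by positivity
    constructor
    · nlinarith [mul_nonneg hS (sq_nonneg (1 / (y + n) - 1 / (y + n + 1)))]
    · nlinarith [mul_le_mul_of_nonneg_left h2 hS]

theorem abs_one_sub_selbergH_le {y : ℝ} (hy : 0 < y) :
    |1 - selbergH y| ≤ (sin (π * y) / (π * y)) ^ 2 := by
  have hlim := tendsto_selbergH_add_natCast y
  have h1 : selbergH y ≤ 1 := ge_of_tendsto' hlim fun n ↦ (selbergH_add_natCast_mem hy n).1
  have h2 : 1 ≤ selbergH y + (sin (π * y) / (π * y)) ^ 2 := by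
    refine le_of_tendsto' hlim fun n ↦ (selbergH_add_natCast_mem hy n).2.trans ?_
    have h3 : (sin (π * y) / (π * y)) ^ 2 = (sin (π * y) / π) ^ 2 * (1 / y ^ 2) := by
      field_simp
    rw [h3]
    gcongr
    exact sub_le_self _ (by positivity)
  rw [abs_of_nonneg (by linarith)]
  linarith

theorem stmt1 :
    (∃ C : ℝ, 0 < C ∧ ∀ x L : ℝ, 0 < L →
      |Real.sign x - ∫ u in (0:ℝ)..L, selbergG (u / L) * Real.sin (2 * Real.pi * u * x) / u|
        ≤ C * (if x = 0 then 1
               else (Real.sin (Real.pi * L * x) / (Real.pi * L * x)) ^ 2)) ∧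
    (∀ u ∈ Set.Icc (0:ℝ) 1, DifferentiableWithinAt ℝ selbergG (Set.Icc (0:ℝ) 1) u) ∧
    (∀ u ∈ Set.Icc (0:ℝ) 1, 0 ≤ selbergG u ∧ selbergG u ≤ 2 / Real.pi) := by
  refine ⟨⟨1, one_pos, fun x L hL ↦ ?_⟩, fun u hu ↦ differentiableWithinAt_selbergG hu,
    fun u hu ↦ selbergG_mem_Icc hu⟩
  rw [integral_selbergG_div x hL, one_mul, mul_assoc]
  rcases lt_trichotomy x 0 with hx | rfl | hx
  · have h := abs_one_sub_selbergH_le (y := L * -x) (mul_pos hL (neg_pos.2 hx))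
    rw [mul_neg, selbergH_neg, mul_neg, sin_neg, neg_div_neg_eq, sub_neg_eq_add] at h
    rw [sign_of_neg hx, if_neg hx.ne, ← abs_neg]
    rwa [neg_sub, sub_neg_eq_add, add_comm]
  · simp [selbergH_zero]
  · rw [sign_of_pos hx, if_neg hx.ne']
    exact abs_one_sub_selbergH_le (mul_pos hL hx)
end

section
/- Let λ > 0, let N be a positive integer, and let c > 0. Then for every y > 0: 0 ≤ (1/2πi)∫_{c−i∞}^{c+i∞} y^s ((e^{λs}−1)/(λs))^N ds/s − χ(y) ≤ (1/2πi)∫_{c−i∞}^{c+i∞} y^s ((e^{λs}−1)/(λs))^N (1−e^{−λNs})/s ds, where χ(y) = 1 if y > 1 and χ(y) = 0 if 0 < y ≤ 1. -/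
open Complex MeasureTheory

/-- `χ(y) = 1` if `y > 1` and `0` otherwise. -/
noncomputable def chiInd (y : ℝ) : ℝ := if 1 < y then 1 else 0

/-- The smoothed Perron kernel integral
`(1/2πi)∫_{c-i∞}^{c+i∞} y^s ((e^{λs}-1)/(λs))^N ds/s`, written as an integral over the
vertical line `Re s = c` (so `ds = i dt` and `1/(2πi) ds = 1/(2π) dt`). -/
noncomputable def perronKernelInt (lam : ℝ) (N : ℕ) (c y : ℝ) : ℂ :=
  (1 / (2 * Real.pi)) *
    ∫ t : ℝ, (y : ℂ) ^ ((c : ℂ) + t * Complex.I) *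
      ((Complex.exp ((lam : ℂ) * ((c : ℂ) + t * Complex.I)) - 1) /
        ((lam : ℂ) * ((c : ℂ) + t * Complex.I))) ^ N / ((c : ℂ) + t * Complex.I)

/-- The corresponding upper-bound integral
`(1/2πi)∫_{c-i∞}^{c+i∞} y^s ((e^{λs}-1)/(λs))^N (1-e^{-λNs})/s ds`. -/
noncomputable def perronErrorInt (lam : ℝ) (N : ℕ) (c y : ℝ) : ℂ :=
  (1 / (2 * Real.pi)) *
    ∫ t : ℝ, (y : ℂ) ^ ((c : ℂ) + t * Complex.I) *
      ((Complex.exp ((lam : ℂ) * ((c : ℂ) + t * Complex.I)) - 1) /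
        ((lam : ℂ) * ((c : ℂ) + t * Complex.I))) ^ N *
      ((1 - Complex.exp (-(lam : ℂ) * (N : ℂ) * ((c : ℂ) + t * Complex.I))) /
        ((c : ℂ) + t * Complex.I))

/-- The `N`-fold multiplicative average, over dilations by `e^{-u}` with `0 ≤ u ≤ lam`, of the
indicator function of `t < 1`. -/
noncomputable def smoothedStep (lam : ℝ) : ℕ → ℝ → ℝ
  | 0, t => if t < 1 then 1 else 0
  | n + 1, t => lam⁻¹ * ∫ u in (0 : ℝ)..lam, smoothedStep lam n (Real.exp (-u) * t)

theorem smoothedStep_antitone_and_mem_Icc {lam : ℝ} (hlam : 0 < lam) (n : ℕ) :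
    Antitone (smoothedStep lam n) ∧ ∀ t, smoothedStep lam n t ∈ Set.Icc (0 : ℝ) 1 := by
  induction n with
  | zero =>
    refine ⟨fun a b hab => ?_, fun t => ?_⟩ <;> simp only [smoothedStep, Set.mem_Icc] <;>
      split_ifs <;> first | (exfalso; linarith) | norm_num
  | succ n ih =>
    obtain ⟨hanti, hmem⟩ := ih
    have hint (t : ℝ) : IntervalIntegrable (fun u => smoothedStep lam n (Real.exp (-u) * t))
        volume 0 lam := by
      refine (intervalIntegrable_const (c := (1 : ℝ))).mono_fun'
        (hanti.measurable.comp (by fun_prop)).aestronglyMeasurable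
        (Filter.Eventually.of_forall fun u => ?_)
      have := hmem (Real.exp (-u) * t)
      exact abs_le.2 ⟨by linarith [this.1], this.2⟩
    refine ⟨fun a b hab => ?_, fun t => ⟨?_, ?_⟩⟩
    · simp only [smoothedStep]
      gcongr
      refine intervalIntegral.integral_mono_on hlam.le (hint b) (hint a) fun u _ => hanti ?_
      gcongr
    · simp only [smoothedStep]
      have := intervalIntegral.integral_nonneg (μ := volume) hlam.le
        fun u _ => (hmem (Real.exp (-u) * t)).1
      positivity
    · simp only [smoothedStep]
      have := intervalIntegral.integral_mono_on hlam.le (hint t)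
        (intervalIntegrable_const (c := (1 : ℝ))) fun u _ => (hmem (Real.exp (-u) * t)).2
      rw [inv_mul_le_iff₀ hlam]
      simpa using this

theorem measurable_smoothedStep {lam : ℝ} (hlam : 0 < lam) (n : ℕ) :
    Measurable (smoothedStep lam n) :=
  (smoothedStep_antitone_and_mem_Icc hlam n).1.measurable

theorem norm_smoothedStep_le_one {lam : ℝ} (hlam : 0 < lam) (n : ℕ) (t : ℝ) :
    ‖smoothedStep lam n t‖ ≤ 1 := by
  have := (smoothedStep_antitone_and_mem_Icc hlam n).2 t
  exact abs_le.2 ⟨by linarith [this.1], this.2⟩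

theorem smoothedStep_eq_one {lam : ℝ} (hlam : 0 < lam) (n : ℕ) {t : ℝ} (ht0 : 0 < t)
    (ht : t < 1) : smoothedStep lam n t = 1 := by
  induction n generalizing t with
  | zero => simp [smoothedStep, ht]
  | succ n ih =>
    have : ∫ u in (0 : ℝ)..lam, smoothedStep lam n (Real.exp (-u) * t) =
        ∫ _u in (0 : ℝ)..lam, (1 : ℝ) := by
      refine intervalIntegral.integral_congr fun u hu => ih (by positivity) ?_
      rw [Set.uIcc_of_le hlam.le] at hu
      have : Real.exp (-u) ≤ 1 := Real.exp_le_one_iff.2 (by linarith [hu.1])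
      nlinarith
    rw [smoothedStep, this]
    simp [hlam.ne']

theorem smoothedStep_eq_zero {lam : ℝ} (hlam : 0 < lam) (n : ℕ) {t : ℝ}
    (ht : Real.exp (lam * n) ≤ t) : smoothedStep lam n t = 0 := by
  induction n generalizing t with
  | zero => simpa [smoothedStep] using ht
  | succ n ih =>
    have : ∫ u in (0 : ℝ)..lam, smoothedStep lam n (Real.exp (-u) * t) =
        ∫ _u in (0 : ℝ)..lam, (0 : ℝ) := by
      refine intervalIntegral.integral_congr fun u hu => ih ?_
      rw [Set.uIcc_of_le hlam.le] at hu
      calc Real.exp (lam * n) ≤ Real.exp (-u + lam * ↑(n + 1)) := by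
            gcongr
            push_cast
            linarith [hu.2]
        _ = Real.exp (-u) * Real.exp (lam * ↑(n + 1)) := Real.exp_add _ _
        _ ≤ Real.exp (-u) * t := by gcongr
    rw [smoothedStep, this]
    simp

theorem continuousAt_smoothedStep_succ {lam : ℝ} (hlam : 0 < lam) (n : ℕ) {t : ℝ} (ht : 0 < t) :
    ContinuousAt (smoothedStep lam (n + 1)) t := by
  set g : ℝ → ℝ := fun v => smoothedStep lam n (Real.exp v)
  have hg (a b : ℝ) : IntervalIntegrable g volume a b :=
    (intervalIntegrable_const (c := (1 : ℝ))).mono_fun'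
      ((measurable_smoothedStep hlam n).comp Real.measurable_exp).aestronglyMeasurable
      (Filter.Eventually.of_forall fun u => norm_smoothedStep_le_one hlam n _)
  have hF : Continuous fun b => ∫ v in (0 : ℝ)..b, g v :=
    intervalIntegral.continuous_primitive hg 0
  have hlog : ContinuousAt Real.log t := Real.continuousAt_log ht.ne'
  have key : ContinuousAt (fun x => lam⁻¹ * ((∫ v in (0 : ℝ)..Real.log x, g v) -
      ∫ v in (0 : ℝ)..(Real.log x - lam), g v)) t :=
    continuousAt_const.mul ((hF.continuousAt.comp hlog).sub
      ((hF.continuousAt.comp (hlog.sub continuousAt_const))))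
  refine key.congr ?_
  filter_upwards [lt_mem_nhds ht] with x hx
  rw [intervalIntegral.integral_interval_sub_left (hg _ _) (hg _ _), smoothedStep]
  congr 1
  have := intervalIntegral.integral_comp_sub_left (a := 0) (b := lam) g (Real.log x)
  rw [sub_zero] at this
  rw [← this]
  refine intervalIntegral.integral_congr fun u _ => ?_
  simp only [g]
  rw [sub_eq_neg_add, Real.exp_add, Real.exp_log hx]

theorem norm_cpow_mul_smoothedStep_le {lam : ℝ} (hlam : 0 < lam) (n : ℕ) (s : ℂ) {u t : ℝ}
    (hu : u ≤ lam) (ht : 0 < t) :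
    ‖(t : ℂ) ^ (s - 1) * (smoothedStep lam n (Real.exp (-u) * t) : ℂ)‖ ≤
      (Set.Ioc 0 (Real.exp (lam * (n + 1)))).indicator (fun t : ℝ => t ^ (s.re - 1)) t := by
  rw [norm_mul, Complex.norm_cpow_eq_rpow_re_of_pos ht, Complex.norm_real]
  by_cases h : t ≤ Real.exp (lam * (n + 1))
  · rw [Set.indicator_of_mem (Set.mem_Ioc.2 ⟨ht, h⟩)]
    exact mul_le_of_le_one_right (by positivity) (norm_smoothedStep_le_one hlam n _)
  · rw [smoothedStep_eq_zero hlam n, norm_zero, mul_zero]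
    · exact Set.indicator_nonneg (fun x hx => Real.rpow_nonneg hx.1.le _) _
    · push Not at h
      calc Real.exp (lam * n) ≤ Real.exp (-u + lam * (n + 1)) := by
            gcongr
            linarith
        _ = Real.exp (-u) * Real.exp (lam * (n + 1)) := Real.exp_add _ _
        _ ≤ Real.exp (-u) * t := by gcongr

theorem integrableOn_Ioi_indicator_Ioc_rpow {r : ℝ} (hr : 0 < r) {B : ℝ} (hB : 0 ≤ B) :
    IntegrableOn ((Set.Ioc 0 B).indicator (fun t : ℝ => t ^ (r - 1))) (Set.Ioi 0) := by
  have h : IntegrableOn (fun t : ℝ => t ^ (r - 1)) (Set.Ioc 0 B) :=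
    (intervalIntegrable_iff_integrableOn_Ioc_of_le hB).1
      (intervalIntegral.intervalIntegrable_rpow' (by linarith))
  exact ((integrable_indicator_iff measurableSet_Ioc).2 h).integrableOn

theorem mellinConvergent_smoothedStep {lam : ℝ} (hlam : 0 < lam) (n : ℕ) {s : ℂ}
    (hs : 0 < s.re) : MellinConvergent (fun t => (smoothedStep lam n t : ℂ)) s := by
  refine Integrable.mono' (integrableOn_Ioi_indicator_Ioc_rpow hs (Real.exp_nonneg (lam * (n + 1))))
    (Measurable.aestronglyMeasurable ?_)
    ((ae_restrict_iff' measurableSet_Ioi).2 (Filter.Eventually.of_forall fun t ht => ?_))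
  · have := measurable_smoothedStep hlam n
    simp only [smul_eq_mul]
    fun_prop
  · simpa using norm_cpow_mul_smoothedStep_le hlam n s (u := 0) hlam.le ht

theorem mellin_smoothedStep_zero (lam : ℝ) {s : ℂ} (hs : 0 < s.re) :
    mellin (fun t => (smoothedStep lam 0 t : ℂ)) s = 1 / s := by
  rw [← (hasMellin_one_Ioc hs).2, mellin, mellin]
  refine setIntegral_congr_ae measurableSet_Ioi ?_
  filter_upwards [compl_mem_ae_iff.2 (measure_singleton (1 : ℝ))] with t ht ht0
  have h1 : t ≠ 1 := ht
  have h0 : 0 < t := ht0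
  have : t < 1 ↔ t ≤ 1 := ⟨le_of_lt, fun h => lt_of_le_of_ne h h1⟩
  simp [smoothedStep, Set.indicator_apply, h0, this, apply_ite ((↑) : ℝ → ℂ)]

theorem mellin_smoothedStep_succ {lam : ℝ} (hlam : 0 < lam) (n : ℕ) {s : ℂ} (hs : 0 < s.re) :
    mellin (fun t => (smoothedStep lam (n + 1) t : ℂ)) s =
      (Complex.exp (lam * s) - 1) / (lam * s) *
        mellin (fun t => (smoothedStep lam n t : ℂ)) s := by
  have hs0 : s ≠ 0 := by
    rintro rfl
    simp at hs
  have hint : Integrable (Function.uncurry fun (u t : ℝ) =>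
      (t : ℂ) ^ (s - 1) * (smoothedStep lam n (Real.exp (-u) * t) : ℂ))
      ((volume.restrict (Set.uIoc 0 lam)).prod (volume.restrict (Set.Ioi 0))) := by
    have hdom := Integrable.mul_prod
      (intervalIntegrable_iff.1 (intervalIntegrable_const (μ := volume) (a := 0) (b := lam)
        (c := (1 : ℝ))))
      (integrableOn_Ioi_indicator_Ioc_rpow hs (Real.exp_nonneg (lam * (n + 1))))
    refine hdom.mono' (Measurable.aestronglyMeasurable ?_) ?_
    · have := measurable_smoothedStep hlam n
      simp only [Function.uncurry_def]
      fun_prop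
    · rw [Measure.prod_restrict]
      refine (ae_restrict_iff' (measurableSet_uIoc.prod measurableSet_Ioi)).2
        (Filter.Eventually.of_forall ?_)
      rintro ⟨u, t⟩ ⟨hu, ht⟩
      rw [Set.uIoc_of_le hlam.le] at hu
      simpa only [one_mul, Function.uncurry_apply_pair] using norm_cpow_mul_smoothedStep_le hlam n s hu.2 ht
  have hscale (u : ℝ) : ∫ t in Set.Ioi (0 : ℝ),
      (t : ℂ) ^ (s - 1) * (smoothedStep lam n (Real.exp (-u) * t) : ℂ) =
        Complex.exp (s * u) * mellin (fun t => (smoothedStep lam n t : ℂ)) s := by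
    have := mellin_comp_mul_left (fun t => (smoothedStep lam n t : ℂ)) s (Real.exp_pos (-u))
    simp only [mellin, smul_eq_mul] at this ⊢
    rw [this, Complex.cpow_def_of_ne_zero (by exact_mod_cast (Real.exp_pos _).ne'),
      ← Complex.ofReal_log (Real.exp_pos _).le, Real.log_exp]
    congr 2
    push_cast
    ring
  have hswap := intervalIntegral_integral_swap hint
  simp only [hscale] at hswap
  rw [intervalIntegral.integral_mul_const, integral_exp_mul_complex hs0] at hswap
  have hmellin : mellin (fun t => (smoothedStep lam (n + 1) t : ℂ)) s =
      (lam : ℂ)⁻¹ * ∫ t in Set.Ioi (0 : ℝ), ∫ u in (0 : ℝ)..lam,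
        (t : ℂ) ^ (s - 1) * (smoothedStep lam n (Real.exp (-u) * t) : ℂ) := by
    rw [mellin, ← integral_const_mul]
    congr 1 with t
    rw [intervalIntegral.integral_const_mul, intervalIntegral.integral_ofReal, smoothedStep,
      smul_eq_mul]
    push_cast
    ring
  rw [hmellin, ← hswap]
  have : (lam : ℂ) ≠ 0 := by exact_mod_cast hlam.ne'
  simp only [Complex.ofReal_zero, mul_zero, Complex.exp_zero]
  rw [mul_comm s]
  field_simp

theorem mellin_smoothedStep {lam : ℝ} (hlam : 0 < lam) (n : ℕ) {s : ℂ} (hs : 0 < s.re) :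
    mellin (fun t => (smoothedStep lam n t : ℂ)) s =
      ((Complex.exp (lam * s) - 1) / (lam * s)) ^ n / s := by
  induction n with
  | zero => rw [mellin_smoothedStep_zero lam hs, pow_zero]
  | succ n ih => rw [mellin_smoothedStep_succ hlam n hs, ih, pow_succ']; ring

theorem integrable_perronKernel (lam : ℝ) {N : ℕ} (hN : 0 < N) {c : ℝ} (hc : 0 < c) :
    Integrable fun t : ℝ => ((Complex.exp ((lam : ℂ) * ((c : ℂ) + t * Complex.I)) - 1) /
      ((lam : ℂ) * ((c : ℂ) + t * Complex.I))) ^ N / ((c : ℂ) + t * Complex.I) := by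
  obtain ⟨n, rfl⟩ := Nat.exists_eq_succ_of_ne_zero hN.ne'
  set K : ℝ := (Real.exp (lam * c) + 1) / |lam|
  have hK : 0 ≤ K := by positivity
  have hdom : Integrable fun t : ℝ => (K / c) ^ n * K * ((c ^ 2)⁻¹ * (1 + (t / c) ^ 2)⁻¹) :=
    ((integrable_inv_one_add_sq.comp_div hc.ne').const_mul _).const_mul _
  refine hdom.mono' (Measurable.aestronglyMeasurable (by fun_prop))
    (Filter.Eventually.of_forall fun t => ?_)
  set s : ℂ := (c : ℂ) + t * Complex.I with hs
  have hre : s.re = c := by simp [hs]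
  have hsc : c ≤ ‖s‖ := by simpa only [hre] using Complex.re_le_norm s
  have hs0 : 0 < ‖s‖ := hc.trans_le hsc
  have hsq : ‖s‖ ^ 2 = c ^ 2 + t ^ 2 := by
    rw [Complex.sq_norm, Complex.normSq_apply]
    simp [hs, sq]
  have hq : ‖(Complex.exp (lam * s) - 1) / (lam * s)‖ ≤ K / ‖s‖ := by
    rw [norm_div, norm_mul, Complex.norm_real, Real.norm_eq_abs, div_div]
    gcongr
    refine (norm_sub_le _ _).trans ?_
    rw [Complex.norm_exp, norm_one, Complex.re_ofReal_mul, hre]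
  rw [norm_div, norm_pow, pow_succ]
  calc _ ≤ (K / c) ^ n * (K / ‖s‖) / ‖s‖ := by
        gcongr
        exact hq.trans (by gcongr)
    _ = (K / c) ^ n * K * (‖s‖ ^ 2)⁻¹ := by field_simp
    _ = _ := by
        rw [hsq, ← mul_inv]
        congr 2
        field_simp

theorem perronKernelInt_eq {lam : ℝ} (hlam : 0 < lam) {N : ℕ} (hN : 0 < N) {c : ℝ} (hc : 0 < c)
    {y : ℝ} (hy : 0 < y) : perronKernelInt lam N c y = smoothedStep lam N y⁻¹ := by
  obtain ⟨n, rfl⟩ := Nat.exists_eq_succ_of_ne_zero hN.ne'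
  have hM (t : ℝ) := mellin_smoothedStep hlam (n + 1) (s := (c : ℂ) + t * Complex.I) (by simpa)
  have hinv := mellinInv_mellin_eq c (fun t => (smoothedStep lam (n + 1) t : ℂ)) (inv_pos.2 hy)
    (mellinConvergent_smoothedStep hlam (n + 1) (by simpa))
    (by
      simp only [Complex.VerticalIntegrable, hM]
      exact integrable_perronKernel lam hN hc)
    (Complex.continuous_ofReal.continuousAt.comp
      (continuousAt_smoothedStep_succ hlam n (inv_pos.2 hy)))
  have hpow (s : ℂ) : ((y⁻¹ : ℝ) : ℂ) ^ (-s) = (y : ℂ) ^ s := by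
    rw [Complex.ofReal_inv, Complex.inv_cpow _ _ (by
      rw [Complex.arg_ofReal_of_nonneg hy.le]; exact Real.pi_pos.ne), Complex.cpow_neg, inv_inv]
  simp only [mellinInv, hM, hpow] at hinv
  rw [← hinv, perronKernelInt, Complex.real_smul]
  push_cast
  congr 2 with t
  rw [smul_eq_mul, mul_div_assoc]

theorem perronErrorInt_eq_sub {lam : ℝ} {N : ℕ} (hN : 0 < N) {c : ℝ}
    (hc : 0 < c) {y : ℝ} (hy : 0 < y) :
    perronErrorInt lam N c y =
      perronKernelInt lam N c y - perronKernelInt lam N c (y * Real.exp (-(lam * N))) := by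
  have hint {x : ℝ} (hx : 0 < x) : Integrable fun t : ℝ => (x : ℂ) ^ ((c : ℂ) + t * Complex.I) *
      ((Complex.exp ((lam : ℂ) * ((c : ℂ) + t * Complex.I)) - 1) /
        ((lam : ℂ) * ((c : ℂ) + t * Complex.I))) ^ N / ((c : ℂ) + t * Complex.I) := by
    simp only [mul_div_assoc]
    refine (integrable_perronKernel lam hN hc).bdd_mul (c := x ^ c)
      (Measurable.aestronglyMeasurable (by fun_prop)) (Filter.Eventually.of_forall fun t => ?_)
    rw [Complex.norm_cpow_eq_rpow_re_of_pos hx]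
    simp
  have hy' : 0 < y * Real.exp (-(lam * N)) := by positivity
  rw [perronErrorInt, perronKernelInt, perronKernelInt, ← mul_sub,
    ← integral_sub (hint hy) (hint hy')]
  congr 2 with t
  rw [Complex.ofReal_mul, Complex.mul_cpow_ofReal_nonneg hy.le (Real.exp_nonneg _),
    Complex.ofReal_exp, Complex.cpow_def_of_ne_zero (Complex.exp_ne_zero _),
    ← Complex.ofReal_exp, ← Complex.ofReal_log (Real.exp_nonneg _), Real.log_exp]
  push_cast
  rw [← neg_mul]
  ring

theorem stmt2 (lam : ℝ) (hlam : 0 < lam) (N : ℕ) (hN : 0 < N) (c : ℝ) (hc : 0 < c)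
    (y : ℝ) (hy : 0 < y) :
    0 ≤ (perronKernelInt lam N c y).re - chiInd y ∧
      (perronKernelInt lam N c y).re - chiInd y ≤ (perronErrorInt lam N c y).re := by
  rw [perronErrorInt_eq_sub hN hc hy, perronKernelInt_eq hlam hN hc hy,
    perronKernelInt_eq hlam hN hc (by positivity), Complex.sub_re, Complex.ofReal_re,
    Complex.ofReal_re, chiInd]
  have hmem := (smoothedStep_antitone_and_mem_Icc hlam N).2
  split_ifs with h
  · rw [smoothedStep_eq_one hlam N (inv_pos.2 hy) (inv_lt_one_of_one_lt₀ h)]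
    exact ⟨by simp, by linarith [(hmem (y * Real.exp (-(lam * N)))⁻¹).2]⟩
  · rw [smoothedStep_eq_zero hlam N (t := (y * Real.exp (-(lam * N)))⁻¹)]
    · exact ⟨by linarith [(hmem y⁻¹).1], le_rfl⟩
    · rw [mul_inv, ← Real.exp_neg, neg_neg]
      exact le_mul_of_one_le_left (Real.exp_nonneg _) (one_le_inv_iff₀.2 ⟨hy, not_lt.1 h⟩)
end
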